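/- arXiv:2604.25970 — 2 statements merged into one kernel-verified Lean document; each statement's English description precedes it below -/
import Mathlib

section
/- For each m ≥ 1 let A_m(z) = ∑_{k=0}^{m−1} ⟨m, k⟩ z^k be the Eulerian polynomial of type A, where ⟨m, k⟩ is the number of permutations of {0, …, m−1} with exactly k descents. Suppose that for each n ≥ 2 there exists a_n > 0 with A_{2n}(−a_n) = 0 and a_n ≤ a for every a > 0 satisfying A_{2n}(−a) = 0 (i.e. −a_n is the negative zero of A_{2n} closest to the origin, all zeros of A_{2n} being real and negative). Then a_n → 0 as n → ∞. -/
open Polynomial Filter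

open scoped Classical in
/-- The Eulerian polynomial of type A: `A_m(z) = ∑_{k=0}^{m−1} ⟨m,k⟩ z^k`, where
`⟨m,k⟩` counts permutations of `Fin m` with exactly `k` descents (indices `i` with
`i+1 < m` and `σ i > σ (i+1)`). -/
noncomputable def eulerianA (m : ℕ) : Polynomial ℝ :=
  ∑ k ∈ Finset.range m,
    Polynomial.C
      ((Finset.univ.filter (fun σ : Equiv.Perm (Fin m) =>
        (Finset.univ.filter (fun i : Fin m =>
          ∃ h : (i : ℕ) + 1 < m, σ ⟨(i : ℕ) + 1, h⟩ < σ i)).card = k)).card : ℝ) *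
      Polynomial.X ^ k

open scoped Classical in
/-- The set of descents of a permutation of `Fin m`. -/
noncomputable def descents {m : ℕ} (σ : Equiv.Perm (Fin m)) : Finset (Fin m) :=
  Finset.univ.filter fun i : Fin m => ∃ h : (i : ℕ) + 1 < m, σ ⟨(i : ℕ) + 1, h⟩ < σ i

theorem mem_descents {m : ℕ} {σ : Equiv.Perm (Fin m)} {i : Fin m} :
    i ∈ descents σ ↔ ∃ h : (i : ℕ) + 1 < m, σ ⟨(i : ℕ) + 1, h⟩ < σ i := by
  simp [descents]

theorem eulerianA_coeff {m k : ℕ} (hk : k < m) :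
    (eulerianA m).coeff k =
      ((Finset.univ.filter fun σ : Equiv.Perm (Fin m) => (descents σ).card = k).card : ℝ) := by
  simp only [eulerianA, finsetSum_coeff, coeff_C_mul_X_pow]
  rw [Finset.sum_ite_eq, if_pos (Finset.mem_range.2 hk)]
  simp only [descents]
  congr!

theorem natDegree_eulerianA_le (m : ℕ) : (eulerianA m).natDegree ≤ m - 1 := by
  refine natDegree_sum_le_of_forall_le _ _ fun k hk => ?_
  have := Finset.mem_range.1 hk
  exact (natDegree_C_mul_X_pow_le _ _).trans (by omega)

/-- The identity is the only permutation without descents. -/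
theorem descents_card_eq_zero_iff {m : ℕ} {σ : Equiv.Perm (Fin m)} :
    (descents σ).card = 0 ↔ σ = 1 := by
  rw [Finset.card_eq_zero, Finset.eq_empty_iff_forall_notMem]
  constructor
  · intro h
    have hmono : StrictMono σ := by
      cases m with
      | zero => exact fun i => i.elim0
      | succ n =>
        rw [Fin.strictMono_iff_lt_succ]
        intro i
        have hi := h i.castSucc
        rw [mem_descents, not_exists] at hi
        refine lt_of_le_of_ne (not_lt.1 (hi (by simp))) fun he => ?_
        exact absurd (σ.injective he) (Fin.castSucc_lt_succ).ne
    have : σ.toOrderIso hmono.monotone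
        (fun i j hij => by simpa using hmono.le_iff_le.1 (by simpa using hij)) =
        OrderIso.refl (Fin m) := Subsingleton.elim _ _
    ext i
    exact congrArg (fun e : Fin m ≃o Fin m => (e i : ℕ)) this
  · rintro rfl i hi
    obtain ⟨h, hlt⟩ := mem_descents.1 hi
    simp [Fin.lt_def] at hlt

theorem eulerianA_coeff_zero {m : ℕ} (hm : 0 < m) : (eulerianA m).coeff 0 = 1 := by
  rw [eulerianA_coeff hm]
  simp only [descents_card_eq_zero_iff]
  simp [Finset.filter_eq']

theorem val_cycleIcc {m : ℕ} {i j : Fin m} (hij : i < j) (k : Fin m) :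
    (Fin.cycleIcc i j k : ℕ) =
      if (k : ℕ) < i then (k : ℕ) else if (k : ℕ) < j then (k : ℕ) + 1
        else if (k : ℕ) = j then (i : ℕ) else (k : ℕ) := by
  have : NeZero m := ⟨by have := i.2; omega⟩
  rw [Fin.lt_def] at hij
  split_ifs with h₁ h₂ h₃
  · rw [Fin.cycleIcc_of_lt h₁]
  · rw [Fin.cycleIcc_of_ge_of_lt (Fin.le_def.2 (not_lt.1 h₁)) h₂, Fin.val_add_one_of_lt' (by omega)]
  · obtain rfl : k = j := Fin.ext h₃
    rw [Fin.cycleIcc_of_last (Fin.le_def.2 hij.le)]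
  · rw [Fin.cycleIcc_of_gt (Fin.lt_def.2 (by omega))]

theorem descents_cycleIcc_card {m : ℕ} {i j : Fin m} (hij : i < j) :
    (descents (Fin.cycleIcc i j)).card = 1 := by
  have hj := j.2
  have hij' := Fin.lt_def.1 hij
  refine Finset.card_eq_one.2 ⟨⟨(j : ℕ) - 1, by omega⟩, ?_⟩
  ext k
  simp only [mem_descents, Finset.mem_singleton, Fin.lt_def, val_cycleIcc hij, Fin.ext_iff]
  constructor
  · rintro ⟨h, hlt⟩
    split_ifs at hlt <;> omega
  · intro h
    refine ⟨by omega, ?_⟩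
    split_ifs <;> omega

theorem cycleIcc_inj {m : ℕ} {i j i' j' : Fin m} (hij : i < j) (hij' : i' < j')
    (h : Fin.cycleIcc i j = Fin.cycleIcc i' j') : i = i' ∧ j = j' := by
  have key (k : Fin m) := congrArg (fun σ : Equiv.Perm (Fin m) => (σ k : ℕ)) h
  simp only [val_cycleIcc hij, val_cycleIcc hij'] at key
  have hi := key i
  have hi' := key i'
  have hj := key j
  have hj' := key j'
  simp only [Fin.lt_def, Fin.ext_iff] at *
  grind

theorem le_eulerianA_coeff_one {m : ℕ} (hm : 1 < m) :
    (m : ℝ) * (m - 1) / 2 ≤ (eulerianA m).coeff 1 := by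
  classical
  rw [eulerianA_coeff hm]
  have hle : (Finset.univ.sigma fun j : Fin m => Finset.Iio j).card ≤
      (Finset.univ.filter fun σ : Equiv.Perm (Fin m) => (descents σ).card = 1).card := by
    refine Finset.card_le_card_of_injOn (fun p => Fin.cycleIcc p.2 p.1) ?_ ?_
    · intro p hp
      have hp : p.2 < p.1 := by simpa using hp
      simpa using descents_cycleIcc_card hp
    · rintro ⟨j, i⟩ hp ⟨j', i'⟩ hp' h
      have hp : i < j := by simpa using hp
      have hp' : i' < j' := by simpa using hp'
      obtain ⟨rfl, rfl⟩ := cycleIcc_inj hp hp' h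
      rfl
  rw [Finset.card_sigma] at hle
  simp only [Fin.card_Iio] at hle
  rw [Fin.sum_univ_eq_sum_range fun j => j] at hle
  have hsum : (((∑ j ∈ Finset.range m, j) * 2 : ℕ) : ℝ) = m * (m - 1) := by
    rw [Finset.sum_range_id_mul_two, Nat.cast_mul, Nat.cast_pred (by omega)]
  have : ((∑ j ∈ Finset.range m, j : ℕ) : ℝ) ≤ _ := Nat.cast_le.2 hle
  rw [Nat.cast_mul] at hsum
  push_cast at this hsum ⊢
  linarith

/-- If all complex zeros of `p` are negative reals of modulus at least `a`, then the logarithmic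
derivative of `p` at the origin is at most `p.natDegree / a`. -/
theorem coeff_one_div_coeff_zero_le {p : ℝ[X]} {a : ℝ} (ha : 0 < a) (hp : p.coeff 0 ≠ 0)
    (hroots : ∀ z : ℂ, (p.map (algebraMap ℝ ℂ)).IsRoot z → ∃ r : ℝ, r ≤ -a ∧ z = (r : ℂ)) :
    p.coeff 1 / p.coeff 0 ≤ p.natDegree / a := by
  set P := p.map (algebraMap ℝ ℂ) with hP
  have hP0 : P.eval 0 ≠ 0 := by
    rw [← coeff_zero_eq_eval_zero, hP, coeff_map]
    simpa using hp
  have hlog := (IsAlgClosed.splits P).eval_derivative_div_eval_of_ne_zero hP0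
  rw [← coeff_zero_eq_eval_zero, ← coeff_zero_eq_eval_zero, coeff_derivative, hP, coeff_map,
    coeff_map, ← hP] at hlog
  have hre := congrArg Complex.re hlog
  rw [← Complex.coe_reAddGroupHom, map_multiset_sum, Multiset.map_map] at hre
  have hbound : (P.roots.map (Complex.reAddGroupHom ∘ fun z => 1 / (0 - z))).sum ≤
      P.roots.card • (1 / a) := by
    rw [← Multiset.card_map (Complex.reAddGroupHom ∘ fun z => 1 / (0 - z))]
    refine Multiset.sum_le_card_nsmul _ _ fun x hx => ?_
    obtain ⟨z, hz, rfl⟩ := Multiset.mem_map.1 hx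
    obtain ⟨r, hr, rfl⟩ := hroots z (isRoot_of_mem_roots hz)
    have : (1 / (0 - (r : ℂ))) = ((1 / (-r) : ℝ) : ℂ) := by push_cast; simp
    simp only [Function.comp_apply, this, Complex.coe_reAddGroupHom, Complex.ofReal_re]
    exact one_div_le_one_div_of_le ha (by linarith)
  have hcard : P.roots.card ≤ p.natDegree := (card_roots' P).trans natDegree_map_le
  have hval : Complex.reAddGroupHom ((algebraMap ℝ ℂ) (p.coeff (0 + 1)) * (((0 : ℕ) : ℂ) + 1) /
      (algebraMap ℝ ℂ) (p.coeff 0)) = p.coeff 1 / p.coeff 0 := by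
    simp [← Complex.ofReal_div]
  rw [← hval, hre]
  refine hbound.trans ?_
  rw [nsmul_eq_mul, mul_one_div]
  gcongr

/-- If for each `n ≥ 2`, `−a_n` is the negative zero of `A_{2n}` closest to
the origin (all complex roots of `A_{2n}` being negative reals), then `a_n → 0`. -/
theorem stmt_9 (a : ℕ → ℝ)
    (hpos : ∀ n, 2 ≤ n → 0 < a n)
    (hroot : ∀ n, 2 ≤ n → (eulerianA (2 * n)).eval (-(a n)) = 0)
    (hmin : ∀ n, 2 ≤ n → ∀ b : ℝ, 0 < b → (eulerianA (2 * n)).eval (-b) = 0 → a n ≤ b)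
    (hneg : ∀ n, 2 ≤ n → ∀ z : ℂ,
      ((eulerianA (2 * n)).map (algebraMap ℝ ℂ)).IsRoot z → ∃ r : ℝ, r < 0 ∧ z = (r : ℂ)) :
    Tendsto a atTop (nhds 0) := by
  have hbound (n : ℕ) (hn : 2 ≤ n) : a n ≤ 1 / n := by
    have hc0 : (eulerianA (2 * n)).coeff 0 = 1 := eulerianA_coeff_zero (by omega)
    have hlog := coeff_one_div_coeff_zero_le (hpos n hn) (hc0 ▸ one_ne_zero) fun z hz => by
      obtain ⟨r, hr, rfl⟩ := hneg n hn z hz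
      refine ⟨r, ?_, rfl⟩
      have hr0 : (eulerianA (2 * n)).eval r = 0 := by
        rw [IsRoot, ← Complex.coe_algebraMap, eval_map_apply] at hz
        simpa using hz
      linarith [hmin n hn (-r) (by linarith) (by simpa using hr0)]
    rw [hc0, div_one] at hlog
    have hc1 := (le_eulerianA_coeff_one (m := 2 * n) (by omega)).trans hlog
    have hdeg : ((eulerianA (2 * n)).natDegree : ℝ) ≤ 2 * n - 1 := by
      have := natDegree_eulerianA_le (2 * n)
      rw [le_sub_iff_add_le]
      exact_mod_cast (by omega : (eulerianA (2 * n)).natDegree + 1 ≤ 2 * n)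
    have hn' : (2 : ℝ) ≤ n := by exact_mod_cast hn
    have hm : (0 : ℝ) < 2 * n - 1 := by linarith
    rw [le_div_iff₀ (hpos n hn)] at hc1
    push_cast at hc1
    rw [le_div_iff₀ (by linarith)]
    refine le_of_mul_le_mul_right ?_ hm
    linarith
  refine tendsto_of_tendsto_of_tendsto_of_le_of_le' tendsto_const_nhds
    tendsto_one_div_atTop_nhds_zero_nat ?_ ?_
  · filter_upwards [eventually_ge_atTop 2] with n hn using (hpos n hn).le
  · filter_upwards [eventually_ge_atTop 2] with n hn using hbound n hn
end

section
/- For each n ≥ 2 let B_{2n−1} be a real polynomial satisfying the formal power series identity (B_{2n−1} viewed as a power series) = (1 − X)^{2n} · ∑_{k≥0} (2k+1)^{2n−1} X^k, i.e. B_{2n−1} is the Eulerian polynomial of type B of degree 2n−1. Suppose there exists b_n > 0 with B_{2n−1}(−b_n) = 0, b_n ≤ b for every b > 0 with B_{2n−1}(−b) = 0, and such that every complex root of B_{2n−1} is a negative real number. Then b_n → 0 as n → ∞. -/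
open Polynomial Filter

/-- Multiplying a generating function by `(1 - X) ^ N` takes `N`-th forward differences of its
coefficients, apart from the first `N` of them. -/
lemma PowerSeries.coeff_one_sub_X_pow_mul_mk {R : Type*} [CommRing R] (f : R → R) (N k : ℕ) :
    PowerSeries.coeff (k + N) ((1 - PowerSeries.X) ^ N * PowerSeries.mk fun j : ℕ => f j) =
      (fwdDiff (1 : R))^[N] f k := by
  induction N generalizing k with
  | zero => simp
  | succ N ih =>
    rw [pow_succ', mul_assoc, sub_mul, one_mul, map_sub, ← add_assoc,
      PowerSeries.coeff_succ_X_mul, ih, add_right_comm, ih, Function.iterate_succ_apply', fwdDiff]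
    push_cast
    rfl

lemma PowerSeries.coeff_one_one_sub_X_pow_mul {R : Type*} [CommRing R] (φ : PowerSeries R)
    (N : ℕ) :
    PowerSeries.coeff 1 ((1 - PowerSeries.X) ^ N * φ) =
      PowerSeries.coeff 1 φ - N * PowerSeries.coeff 0 φ := by
  induction N with
  | zero => simp
  | succ N ih =>
    have h : PowerSeries.coeff 1 (PowerSeries.X * ((1 - PowerSeries.X) ^ N * φ)) =
        PowerSeries.coeff 0 ((1 - PowerSeries.X) ^ N * φ) :=
      PowerSeries.coeff_succ_X_mul 0 _
    rw [pow_succ', mul_assoc, sub_mul, one_mul, map_sub, ih, h]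
    simp
    ring

/-- A polynomial equal, as a power series, to `(1 - X) ^ (m + 1) * ∑ P(k) X ^ k` with
`P` of degree at most `m` has degree at most `m`. -/
lemma Polynomial.natDegree_le_of_coe_eq_one_sub_X_pow_mul_mk {R : Type*} [CommRing R]
    {B P : R[X]} {m : ℕ} (hP : P.natDegree ≤ m)
    (hB : (B : PowerSeries R) =
      (1 - PowerSeries.X) ^ (m + 1) * PowerSeries.mk fun k : ℕ => P.eval (k : R)) :
    B.natDegree ≤ m := by
  rw [natDegree_le_iff_coeff_eq_zero]
  intro j hj
  obtain ⟨k, rfl⟩ := Nat.exists_eq_add_of_le' (Nat.succ_le_of_lt hj)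
  rw [← Polynomial.coeff_coe, hB, Nat.succ_eq_add_one,
    PowerSeries.coeff_one_sub_X_pow_mul_mk (fun x => P.eval x),
    P.fwdDiff_iter_eq_zero_of_degree_lt (Nat.lt_succ_of_le hP)]
  rfl

/-- The logarithmic derivative at the origin is bounded by the number of roots divided by
the distance from the origin to the closest one. -/
lemma Polynomial.norm_coeff_one_mul_le {p : ℂ[X]} {b : ℝ} (hb : 0 < b)
    (h0 : p.coeff 0 ≠ 0) (hroot : ∀ z, p.IsRoot z → b ≤ ‖z‖) :
    ‖p.coeff 1‖ * b ≤ p.natDegree * ‖p.coeff 0‖ := by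
  have hp : p ≠ 0 := by rintro rfl; simp at h0
  have hlog := (IsAlgClosed.splits p).eval_derivative_div_eval_of_ne_zero (x := 0)
    (by rwa [← coeff_zero_eq_eval_zero])
  rw [← coeff_zero_eq_eval_zero, ← coeff_zero_eq_eval_zero, coeff_derivative] at hlog
  have hsum : ‖p.coeff 1 / p.coeff 0‖ ≤ p.natDegree * b⁻¹ := by
    have h1 : p.coeff 1 / p.coeff 0 = (p.roots.map fun z => 1 / (0 - z)).sum := by
      simpa using hlog
    rw [h1]
    refine (norm_multiset_sum_le _).trans ?_
    rw [Multiset.map_map]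
    refine (Multiset.sum_le_card_nsmul _ b⁻¹ ?_).trans ?_
    · intro x hx
      obtain ⟨z, hz, rfl⟩ := Multiset.mem_map.1 hx
      have hbz := hroot z ((mem_roots hp).1 hz)
      simpa using inv_anti₀ hb hbz
    · rw [Multiset.card_map, nsmul_eq_mul]
      gcongr
      exact card_roots' p
  rw [norm_div, div_le_iff₀ (norm_pos_iff.2 h0)] at hsum
  calc ‖p.coeff 1‖ * b ≤ p.natDegree * b⁻¹ * ‖p.coeff 0‖ * b := by gcongr
    _ = p.natDegree * ‖p.coeff 0‖ := by field_simp

lemma two_mul_add_mul_le_three_pow {n : ℕ} (hn : 2 ≤ n) :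
    2 * n + n * (2 * n - 1) ≤ 3 ^ (2 * n - 1) := by
  obtain ⟨k, rfl⟩ := Nat.exists_eq_add_of_le hn
  rw [show 2 * (2 + k) - 1 = 2 * k + 3 by omega]
  clear hn
  induction k with
  | zero => norm_num
  | succ k ih =>
    rw [show 2 * (k + 1) + 3 = (2 * k + 3) + 2 by ring, pow_add]
    nlinarith

/-- For each `n ≥ 2` let `B_{2n−1}` be the real polynomial with
`(B_{2n−1} : ℝ⟦X⟧) = (1 − X)^{2n} · ∑_{k≥0} (2k+1)^{2n−1} X^k` (the Eulerian polynomial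
of type B). If `−b_n` is its negative zero closest to the origin, all complex roots
being negative reals, then `b_n → 0`. -/
theorem stmt_11 (B : ℕ → Polynomial ℝ) (b : ℕ → ℝ)
    (hB : ∀ n, 2 ≤ n → (↑(B n) : PowerSeries ℝ) =
      (1 - PowerSeries.X) ^ (2 * n) *
        PowerSeries.mk (fun k : ℕ => ((2 * k + 1 : ℝ)) ^ (2 * n - 1)))
    (hpos : ∀ n, 2 ≤ n → 0 < b n)
    (hroot : ∀ n, 2 ≤ n → (B n).eval (-(b n)) = 0)
    (hmin : ∀ n, 2 ≤ n → ∀ c : ℝ, 0 < c → (B n).eval (-c) = 0 → b n ≤ c)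
    (hneg : ∀ n, 2 ≤ n → ∀ z : ℂ,
      ((B n).map (algebraMap ℝ ℂ)).IsRoot z → ∃ r : ℝ, r < 0 ∧ z = (r : ℂ)) :
    Tendsto b atTop (nhds 0) := by
  have hbound : ∀ n, 2 ≤ n → b n ≤ 1 / n := by
    intro n hn
    obtain ⟨m, hm⟩ : ∃ m, 2 * n = m + 1 := ⟨2 * n - 1, by omega⟩
    have hm' : 2 * n - 1 = m := by omega
    have hser := hB n hn
    have hthree := two_mul_add_mul_le_three_pow hn
    rw [hm, Nat.add_sub_cancel] at hser hthree
    have hdeg : (B n).natDegree ≤ m := by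
      refine natDegree_le_of_coe_eq_one_sub_X_pow_mul_mk (P := (C 2 * X + 1) ^ m) ?_ ?_
      · compute_degree
      · simpa using hser
    have hc0 : (B n).coeff 0 = 1 := by
      rw [← Polynomial.coeff_coe, hser]
      simp
    have hc1 : (B n).coeff 1 = 3 ^ m - (m + 1) := by
      rw [← Polynomial.coeff_coe, hser, PowerSeries.coeff_one_one_sub_X_pow_mul]
      norm_num
    have hmain := norm_coeff_one_mul_le (p := (B n).map (algebraMap ℝ ℂ)) (hpos n hn)
      (by simp [hc0]) (by
        intro z hz
        obtain ⟨r, hr, rfl⟩ := hneg n hn z hz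
        have hr0 : (B n).eval r = 0 :=
          (IsRoot.of_map (f := algebraMap ℝ ℂ) (x := r) hz (algebraMap ℝ ℂ).injective)
        rw [Complex.norm_real, Real.norm_eq_abs, abs_of_neg hr]
        exact hmin n hn (-r) (neg_pos.2 hr) (by rwa [neg_neg]))
    rw [coeff_map, coeff_map, hc0, hc1, natDegree_map, norm_algebraMap', norm_algebraMap',
      norm_one, mul_one] at hmain
    have hthree' : (m + 1 + n * m : ℝ) ≤ 3 ^ m := mod_cast hthree
    have hmpos : (0 : ℝ) < m := by
      have : 0 < m := by omega
      exact_mod_cast this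
    have hnpos : (0 : ℝ) < n := by
      have : 0 < n := by omega
      exact_mod_cast this
    rw [le_div_iff₀ hnpos]
    have hchain : (n * m : ℝ) * b n ≤ m := by
      calc (n * m : ℝ) * b n ≤ ‖(3 ^ m - (m + 1) : ℝ)‖ * b n := by
            have := (hpos n hn).le
            gcongr
            exact (by linarith : (n * m : ℝ) ≤ 3 ^ m - (m + 1)).trans (Real.le_norm_self _)
        _ ≤ (B n).natDegree := hmain
        _ ≤ m := mod_cast hdeg
    nlinarith
  refine squeeze_zero' ?_ ?_ tendsto_one_div_atTop_nhds_zero_nat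
  · filter_upwards [eventually_ge_atTop 2] with n hn using (hpos n hn).le
  · filter_upwards [eventually_ge_atTop 2] with n hn using hbound n hn
end
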